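/- For every x ∈ S̃_{k+1}, the length of x equals the sum of the entries of its right decreasing code: ℓ(x) = ∑_{i ∈ I} CRD(x)_i. -/

import Mathlib

/-- `x : Equiv.Perm ℤ` is an affine permutation in `S̃_{k+1}`: it commutes with
translation by `k+1` and its window sums to `(k+1)(k+2)/2`. -/
def IsAffinePerm (k : ℕ) (x : Equiv.Perm ℤ) : Prop :=
  (∀ i : ℤ, x (i + (k + 1)) = x i + (k + 1)) ∧
  ∑ i ∈ Finset.Icc (1 : ℤ) (k + 1), x i = (k + 1) * (k + 2) / 2

/-- The underlying function of the simple generator `s_i`. -/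
def sAffFun (k : ℕ) (i : ZMod (k + 1)) (j : ℤ) : ℤ :=
  if (j : ZMod (k + 1)) = i then j + 1
  else if (j : ZMod (k + 1)) = i + 1 then j - 1
  else j

theorem sAffFun_invol (k : ℕ) (i : ZMod (k + 1)) (h : ¬ (1 : ZMod (k + 1)) = 0) :
    Function.Involutive (sAffFun k i) := by
  have hne : i + 1 ≠ i := fun hc => h (by
    have h2 : i + 1 = i + 0 := by simpa using hc
    exact add_left_cancel h2)
  intro j
  by_cases h1 : (j : ZMod (k + 1)) = i
  · have e1 : sAffFun k i j = j + 1 := if_pos h1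
    have hj1 : ((j + 1 : ℤ) : ZMod (k + 1)) = i + 1 := by push_cast; rw [h1]
    have e2 : sAffFun k i (j + 1) = j := by
      unfold sAffFun
      rw [if_neg (by rw [hj1]; exact hne), if_pos hj1]
      ring
    rw [e1, e2]
  · by_cases h2 : (j : ZMod (k + 1)) = i + 1
    · have e1 : sAffFun k i j = j - 1 := by unfold sAffFun; rw [if_neg h1, if_pos h2]
      have hj1 : ((j - 1 : ℤ) : ZMod (k + 1)) = i := by push_cast; rw [h2]; ring
      have e2 : sAffFun k i (j - 1) = j := by
        unfold sAffFun; rw [if_pos hj1]; ring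
      rw [e1, e2]
    · have e1 : sAffFun k i j = j := by unfold sAffFun; rw [if_neg h1, if_neg h2]
      rw [e1, e1]

/-- The simple generator `s_i` of the affine symmetric group, as a permutation of `ℤ`:
it interchanges `m(k+1) + ī` and `m(k+1) + ī + 1` for every `m` (when `k ≥ 1`). -/
noncomputable def sAff (k : ℕ) (i : ZMod (k + 1)) : Equiv.Perm ℤ :=
  if h : (1 : ZMod (k + 1)) = 0 then 1 else Function.Involutive.toPerm _ (sAffFun_invol k i h)

/-- The Coxeter length of `x`: the least number of simple generators whose product is `x`. -/
noncomputable def affLen (k : ℕ) (x : Equiv.Perm ℤ) : ℕ :=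
  sInf {n : ℕ | ∃ w : List (ZMod (k + 1)), w.length = n ∧ x = (w.map (sAff k)).prod}

/-- The right descent set `D_R(x) = {i : ℓ(x s_i) < ℓ(x)}`. -/
noncomputable def rightDescents (k : ℕ) (x : Equiv.Perm ℤ) : Set (ZMod (k + 1)) :=
  {i | affLen k (x * sAff k i) < affLen k x}

/-- The cyclic interval `[i,j] = {i, i+1, …, j}` of residues mod `k+1`. -/
def cycInt (k : ℕ) (i j : ZMod (k + 1)) : Finset (ZMod (k + 1)) :=
  (Finset.range ((j - i).val + 1)).image fun t : ℕ => i + (t : ZMod (k + 1))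

/-- A choice of a "gate" residue not belonging to `A` (when `A` is proper). -/
noncomputable def gate (k : ℕ) (A : Finset (ZMod (k + 1))) : ZMod (k + 1) :=
  if h : ∃ g, g ∉ A then h.choose else 0

/-- The cyclically decreasing element `d_A`: the product of the `s_a`, `a ∈ A`, in an
order where `s_{a+1}` occurs to the left of `s_a` whenever `a, a+1 ∈ A`. -/
noncomputable def dElt (k : ℕ) (A : Finset (ZMod (k + 1))) : Equiv.Perm ℤ :=
  (((((List.range (k + 1)).reverse.map fun t : ℕ => gate k A + (t : ZMod (k + 1))).filter
      fun a => decide (a ∈ A)).map (sAff k)).prod)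

/-- The cyclically increasing element `u_A`: the product of the `s_a`, `a ∈ A`, in an
order where `s_{a+1}` occurs to the right of `s_a` whenever `a, a+1 ∈ A`. -/
noncomputable def uElt (k : ℕ) (A : Finset (ZMod (k + 1))) : Equiv.Perm ℤ :=
  ((((List.range (k + 1)).map fun t : ℕ => gate k A + (t : ZMod (k + 1))).filter
      fun a => decide (a ∈ A)).map (sAff k)).prod

/-- The right decreasing code: `CRD(x)_i = #{j < ī : x(j) > x(ī)}`. -/
noncomputable def CRD (k : ℕ) (x : Equiv.Perm ℤ) (i : ZMod (k + 1)) : ℕ :=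
  Set.ncard {j : ℤ | j < (i.val : ℤ) ∧ x (i.val : ℤ) < x j}

/-- The right increasing code: `CRI(x)_i = #{j > ī + 1 : x(j) < x(ī + 1)}`. -/
noncomputable def CRI (k : ℕ) (x : Equiv.Perm ℤ) (i : ZMod (k + 1)) : ℕ :=
  Set.ncard {j : ℤ | (i.val : ℤ) + 1 < j ∧ x j < x ((i.val : ℤ) + 1)}

/-- The left decreasing code: `CLD(x)_i = #{j < x⁻¹(ī + 1) : x(j) > ī + 1}`. -/
noncomputable def CLD (k : ℕ) (x : Equiv.Perm ℤ) (i : ZMod (k + 1)) : ℕ :=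
  Set.ncard {j : ℤ | j < x.symm ((i.val : ℤ) + 1) ∧ (i.val : ℤ) + 1 < x j}

/-- The left increasing code: `CLI(x)_i = #{j > x⁻¹(ī) : x(j) < ī}`. -/
noncomputable def CLI (k : ℕ) (x : Equiv.Perm ℤ) (i : ZMod (k + 1)) : ℕ :=
  Set.ncard {j : ℤ | x.symm ((i.val : ℤ)) < j ∧ x j < (i.val : ℤ)}

/-- `x` commutes with translation by `k + 1`. -/
def IsPeriodicPerm (k : ℕ) (x : Equiv.Perm ℤ) : Prop :=
  ∀ i : ℤ, x (i + (k + 1)) = x i + (k + 1)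

/-- The positions left of `j` carrying a value larger than `x j`. -/
def leftInversions (x : Equiv.Perm ℤ) (j : ℤ) : Set ℤ := {l | l < j ∧ x j < x l}

theorem one_ne_zero_zmod_succ {k : ℕ} (hk : 1 ≤ k) : (1 : ZMod (k + 1)) ≠ 0 := by
  have : Fact (1 < k + 1) := ⟨by omega⟩
  exact one_ne_zero

theorem sAff_apply {k : ℕ} (hk : 1 ≤ k) (i : ZMod (k + 1)) (j : ℤ) :
    sAff k i j = sAffFun k i j := by
  rw [sAff, dif_neg (one_ne_zero_zmod_succ hk)]
  rfl

theorem sAff_mul_self {k : ℕ} (hk : 1 ≤ k) (i : ZMod (k + 1)) : sAff k i * sAff k i = 1 := by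
  ext j
  simp only [Equiv.Perm.mul_apply, sAff_apply hk, Equiv.Perm.one_apply]
  exact sAffFun_invol k i (one_ne_zero_zmod_succ hk) j

theorem sAff_apply_left {k : ℕ} (hk : 1 ≤ k) {i : ZMod (k + 1)} {j : ℤ}
    (h : (j : ZMod (k + 1)) = i) : sAff k i j = j + 1 := by
  rw [sAff_apply hk, sAffFun, if_pos h]

theorem sAff_apply_right {k : ℕ} (hk : 1 ≤ k) {i : ZMod (k + 1)} {j : ℤ}
    (h : (j : ZMod (k + 1)) = i + 1) : sAff k i j = j - 1 := by
  have h1 : (j : ZMod (k + 1)) ≠ i := by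
    rw [h]; simpa using one_ne_zero_zmod_succ hk
  rw [sAff_apply hk, sAffFun, if_neg h1, if_pos h]

theorem sAff_apply_of_ne {k : ℕ} (hk : 1 ≤ k) {i : ZMod (k + 1)} {j : ℤ}
    (h : (j : ZMod (k + 1)) ≠ i) (h' : (j : ZMod (k + 1)) ≠ i + 1) : sAff k i j = j := by
  rw [sAff_apply hk, sAffFun, if_neg h, if_neg h']

theorem intCast_sAff {k : ℕ} (hk : 1 ≤ k) (i : ZMod (k + 1)) (j : ℤ) :
    ((sAff k i j : ℤ) : ZMod (k + 1)) = Equiv.swap i (i + 1) (j : ZMod (k + 1)) := by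
  by_cases h1 : (j : ZMod (k + 1)) = i
  · rw [sAff_apply_left hk h1, h1]; simp [h1]
  · by_cases h2 : (j : ZMod (k + 1)) = i + 1
    · rw [sAff_apply_right hk h2, h2]; simp [h2]
    · rw [sAff_apply_of_ne hk h1 h2, Equiv.swap_apply_of_ne_of_ne h1 h2]

/-- `s_i` preserves every initial segment `{l < j}` whose end point is not `≡ i + 1`. -/
theorem sAff_lt_iff {k : ℕ} (hk : 1 ≤ k) {i : ZMod (k + 1)} {j : ℤ}
    (hj : (j : ZMod (k + 1)) ≠ i + 1) (l : ℤ) : sAff k i l < j ↔ l < j := by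
  by_cases h1 : (l : ZMod (k + 1)) = i
  · have : l + 1 ≠ j := by
      rintro rfl
      exact hj (by push_cast; rw [h1])
    rw [sAff_apply_left hk h1]; omega
  · by_cases h2 : (l : ZMod (k + 1)) = i + 1
    · have : l ≠ j := by
        rintro rfl
        exact hj h2
      rw [sAff_apply_right hk h2]; omega
    · rw [sAff_apply_of_ne hk h1 h2]

theorem isPeriodicPerm_sAff {k : ℕ} (hk : 1 ≤ k) (i : ZMod (k + 1)) :
    IsPeriodicPerm k (sAff k i) := by
  intro j
  have hc : ((j + (k + 1) : ℤ) : ZMod (k + 1)) = j := by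
    have : (((k + 1 : ℕ) : ℤ) : ZMod (k + 1)) = 0 := by
      rw [Int.cast_natCast]; exact ZMod.natCast_self _
    push_cast at this ⊢
    rw [this, add_zero]
  simp only [sAff_apply hk, sAffFun, hc]
  split_ifs <;> ring

theorem IsPeriodicPerm.mul {k : ℕ} {x y : Equiv.Perm ℤ} (hx : IsPeriodicPerm k x)
    (hy : IsPeriodicPerm k y) : IsPeriodicPerm k (x * y) := by
  intro i
  rw [Equiv.Perm.mul_apply, hy i, hx, Equiv.Perm.mul_apply]

theorem IsPeriodicPerm.apply_add_mul {k : ℕ} {x : Equiv.Perm ℤ} (hx : IsPeriodicPerm k x)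
    (i m : ℤ) : x (i + m * (k + 1)) = x i + m * (k + 1) := by
  induction m using Int.induction_on with
  | zero => simp
  | succ m ih =>
    have := hx (i + m * (k + 1))
    rw [ih] at this
    rw [show i + ((m : ℤ) + 1) * (k + 1) = i + m * (k + 1) + (k + 1) by ring, this]
    ring
  | pred m ih =>
    have := hx (i + (-(m : ℤ) - 1) * (k + 1))
    rw [show i + (-(m : ℤ) - 1) * (k + 1) + (k + 1) = i + -(m : ℤ) * (k + 1) by ring, ih] at this
    linarith

theorem exists_eq_val_add_mul (k : ℕ) (j : ℤ) :
    ∃ m : ℤ, j = ((j : ZMod (k + 1)).val : ℤ) + m * (k + 1) := by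
  refine ⟨j / (k + 1 : ℕ), ?_⟩
  rw [ZMod.val_intCast]
  have := Int.emod_add_mul_ediv j (k + 1 : ℕ)
  push_cast at this ⊢
  linarith

theorem intCast_val_zmod {k : ℕ} (a : ZMod (k + 1)) : ((a.val : ℤ) : ZMod (k + 1)) = a := by
  rw [Int.cast_natCast]; exact ZMod.natCast_zmod_val a

/-- The displacement `x j - j` depends only on the residue of `j`. -/
theorem IsPeriodicPerm.displacement_eq {k : ℕ} {x : Equiv.Perm ℤ} (hx : IsPeriodicPerm k x)
    (j : ℤ) : x ((j : ZMod (k + 1)).val : ℤ) - ((j : ZMod (k + 1)).val : ℤ) = x j - j := by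
  obtain ⟨m, hm⟩ := exists_eq_val_add_mul k j
  have := hx.apply_add_mul ((j : ZMod (k + 1)).val : ℤ) m
  rw [← hm] at this
  linarith

theorem ncard_eq_of_perm {A B : Set ℤ} (e : Equiv.Perm ℤ) (h : ∀ l, l ∈ A ↔ e l ∈ B) :
    A.ncard = B.ncard := by
  have hB : B = e '' A := by
    ext l
    constructor
    · intro hl
      exact ⟨e.symm l, (h _).2 (by simpa using hl), by simp⟩
    · rintro ⟨a, ha, rfl⟩
      exact (h a).1 ha
  rw [hB, Set.ncard_image_of_injective _ e.injective]

theorem IsPeriodicPerm.crd_intCast {k : ℕ} {x : Equiv.Perm ℤ} (hx : IsPeriodicPerm k x)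
    (j : ℤ) : CRD k x (j : ZMod (k + 1)) = (leftInversions x j).ncard := by
  obtain ⟨m, hm⟩ := exists_eq_val_add_mul k j
  refine ncard_eq_of_perm (Equiv.addRight (m * (k + 1))) fun l => ?_
  have h1 := hx.apply_add_mul ((j : ZMod (k + 1)).val : ℤ) m
  rw [← hm] at h1
  have h2 := hx.apply_add_mul l m
  simp only [leftInversions, Set.mem_ofPred_eq, Equiv.coe_addRight, h2, h1]
  constructor <;> rintro ⟨h3, h4⟩ <;> constructor <;> linarith

theorem IsPeriodicPerm.finite_leftInversions {k : ℕ} {x : Equiv.Perm ℤ}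
    (hx : IsPeriodicPerm k x) (j : ℤ) : (leftInversions x j).Finite := by
  obtain ⟨B, hB⟩ := (Set.finite_range
    fun a : ZMod (k + 1) => x (a.val : ℤ) - (a.val : ℤ)).bddAbove
  refine (Set.finite_Ioo (x j - B) j).subset fun l hl => ⟨?_, hl.1⟩
  have h1 := hB ⟨(l : ZMod (k + 1)), rfl⟩
  simp only [hx.displacement_eq] at h1
  have h2 := hl.2
  linarith

theorem IsPeriodicPerm.crd_mul_sAff_swap {k : ℕ} (hk : 1 ≤ k) {x : Equiv.Perm ℤ}
    (hx : IsPeriodicPerm k x) {i : ZMod (k + 1)} (h : x (i.val : ℤ) < x ((i.val : ℤ) + 1))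
    (a : ZMod (k + 1)) :
    CRD k (x * sAff k i) (Equiv.swap i (i + 1) a) = CRD k x a + if a = i then 1 else 0 := by
  have hy := hx.mul (isPeriodicPerm_sAff hk i)
  have hi := intCast_val_zmod i
  have hi' : (((i.val : ℤ) + 1 : ℤ) : ZMod (k + 1)) = i + 1 := by push_cast at hi ⊢; rw [hi]
  have hne : i ≠ i + 1 := by simpa using one_ne_zero_zmod_succ hk
  set j : ℤ := (i.val : ℤ) with hj
  have hsj := sAff_apply_left hk hi
  have hsj' : sAff k i (j + 1) = j := by rw [sAff_apply_right hk hi']; ring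
  have hlt := sAff_lt_iff hk (i := i) (j := j) (by rw [hi]; exact hne)
  by_cases h1 : a = i
  · subst h1
    rw [Equiv.swap_apply_left, if_pos rfl, ← hi', hy.crd_intCast]
    conv_rhs => rw [← hi, hx.crd_intCast]
    rw [← Set.ncard_insert_of_notMem (a := j + 1) (by simp [leftInversions])
      (hx.finite_leftInversions j)]
    refine ncard_eq_of_perm (sAff k a) fun l => ?_
    have hl : sAff k a l = j + 1 ↔ l = j := by rw [← hsj, (sAff k a).injective.eq_iff]
    simp only [leftInversions, Set.mem_ofPred_eq, Set.mem_insert_iff, Equiv.Perm.mul_apply, hsj',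
      hlt l, hl]
    constructor
    · rintro ⟨h3, h4⟩
      by_cases h5 : l = j
      · exact Or.inl h5
      · exact Or.inr ⟨by omega, h4⟩
    · rintro (rfl | ⟨h3, h4⟩)
      · rw [hsj]; exact ⟨by omega, h⟩
      · exact ⟨by omega, h4⟩
  · rw [if_neg h1, add_zero]
    by_cases h2 : a = i + 1
    · rw [h2, Equiv.swap_apply_right]
      conv_lhs => arg 3; rw [← hi]
      rw [← hi', hy.crd_intCast, hx.crd_intCast]
      refine ncard_eq_of_perm (sAff k i) fun l => ?_
      simp only [leftInversions, Set.mem_ofPred_eq, Equiv.Perm.mul_apply, hsj, ← hlt l]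
      refine ⟨fun h3 => ⟨by omega, h3.2⟩, fun h3 => ⟨?_, h3.2⟩⟩
      by_contra h4
      have h5 : sAff k i l = j := by omega
      rw [h5] at h3
      omega
    · rw [Equiv.swap_apply_of_ne_of_ne h1 h2, ← intCast_val_zmod a, hy.crd_intCast,
        hx.crd_intCast]
      have ha := intCast_val_zmod a
      have hsa := sAff_apply_of_ne hk (ha.trans_ne h1) (ha.trans_ne h2)
      have hla := sAff_lt_iff hk (ha.trans_ne h2)
      refine ncard_eq_of_perm (sAff k i) fun l => ?_
      simp only [leftInversions, Set.mem_ofPred_eq, Equiv.Perm.mul_apply, hsa, hla]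

theorem IsPeriodicPerm.sum_crd_mul_sAff_of_ascent {k : ℕ} (hk : 1 ≤ k) {x : Equiv.Perm ℤ}
    (hx : IsPeriodicPerm k x) {i : ZMod (k + 1)} (h : x (i.val : ℤ) < x ((i.val : ℤ) + 1)) :
    ∑ a, CRD k (x * sAff k i) a = ∑ a, CRD k x a + 1 := by
  rw [← Equiv.sum_comp (Equiv.swap i (i + 1))]
  simp [hx.crd_mul_sAff_swap hk h, Finset.sum_add_distrib]

theorem IsPeriodicPerm.sum_crd_mul_sAff_of_descent {k : ℕ} (hk : 1 ≤ k) {x : Equiv.Perm ℤ}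
    (hx : IsPeriodicPerm k x) {i : ZMod (k + 1)} (h : x ((i.val : ℤ) + 1) < x (i.val : ℤ)) :
    ∑ a, CRD k (x * sAff k i) a + 1 = ∑ a, CRD k x a := by
  have hi := intCast_val_zmod i
  have hi' : (((i.val : ℤ) + 1 : ℤ) : ZMod (k + 1)) = i + 1 := by push_cast at hi ⊢; rw [hi]
  rw [← (hx.mul (isPeriodicPerm_sAff hk i)).sum_crd_mul_sAff_of_ascent hk (i := i), mul_assoc,
    sAff_mul_self hk, mul_one]
  rw [Equiv.Perm.mul_apply, Equiv.Perm.mul_apply, sAff_apply_left hk hi, sAff_apply_right hk hi']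
  simpa using h

theorem sum_crd_one (k : ℕ) : ∑ a, CRD k 1 a = 0 := by
  refine Finset.sum_eq_zero fun a _ => ?_
  have : {j : ℤ | j < (a.val : ℤ) ∧ (1 : Equiv.Perm ℤ) (a.val : ℤ) < (1 : Equiv.Perm ℤ) j} = ∅ := by
    ext j
    simp only [Equiv.Perm.one_apply, Set.mem_ofPred_eq, Set.mem_empty_iff_false, iff_false]
    omega
  rw [CRD, this, Set.ncard_empty]

theorem isPeriodicPerm_prod_sAff {k : ℕ} (hk : 1 ≤ k) (w : List (ZMod (k + 1))) :
    IsPeriodicPerm k (w.map (sAff k)).prod := by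
  induction w with
  | nil => intro i; simp
  | cons a w ih =>
    rw [List.map_cons, List.prod_cons]
    exact (isPeriodicPerm_sAff hk a).mul ih

theorem sum_crd_prod_le_length {k : ℕ} (hk : 1 ≤ k) (w : List (ZMod (k + 1))) :
    ∑ a, CRD k (w.map (sAff k)).prod a ≤ w.length := by
  induction w using List.reverseRecOn with
  | nil => simpa using sum_crd_one k
  | append_singleton w i ih =>
    have hx := isPeriodicPerm_prod_sAff hk w
    simp only [List.map_append, List.map_cons, List.map_nil, List.prod_append, List.prod_cons,
      List.prod_nil, mul_one, List.length_append, List.length_cons, List.length_nil]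
    have hne : (w.map (sAff k)).prod (i.val : ℤ) ≠ (w.map (sAff k)).prod ((i.val : ℤ) + 1) :=
      fun h => by simpa using (w.map (sAff k)).prod.injective h
    rcases lt_or_gt_of_ne hne with h | h
    · have := hx.sum_crd_mul_sAff_of_ascent hk h
      omega
    · have := hx.sum_crd_mul_sAff_of_descent hk h
      omega

theorem sum_Icc_intCast_zmod (k : ℕ) (F : ZMod (k + 1) → ℤ) :
    ∑ j ∈ Finset.Icc (1 : ℤ) (k + 1), F (j : ZMod (k + 1)) = ∑ a, F a := by
  refine Finset.sum_bij (fun j _ => (j : ZMod (k + 1))) (fun _ _ => Finset.mem_univ _) ?_ ?_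
    (fun _ _ => rfl)
  · intro a ha b hb hab
    rw [Finset.mem_Icc] at ha hb
    rw [ZMod.intCast_eq_intCast_iff_dvd_sub] at hab
    have := Int.eq_zero_of_abs_lt_dvd hab (by rw [abs_lt]; push_cast; omega)
    omega
  · intro a _
    have ha := intCast_val_zmod (a - 1)
    refine ⟨((a - 1).val : ℤ) + 1, ?_, ?_⟩
    · have := ZMod.val_lt (a - 1)
      rw [Finset.mem_Icc]; omega
    · push_cast at ha ⊢; rw [ha]; ring

theorem sum_Icc_id (k : ℕ) : ∑ j ∈ Finset.Icc (1 : ℤ) (k + 1), j = (k + 1) * (k + 2) / 2 := by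
  have h : ∀ n : ℕ, (∑ j ∈ Finset.Icc (1 : ℤ) n, j) * 2 = n * (n + 1) := by
    intro n
    induction n with
    | zero => simp
    | succ n ih =>
      have : Finset.Icc (1 : ℤ) ((n + 1 : ℕ) : ℤ) = insert ((n : ℤ) + 1) (Finset.Icc 1 (n : ℤ)) := by
        ext; simp only [Finset.mem_Icc, Finset.mem_insert]; omega
      rw [this, Finset.sum_insert (by simp), add_mul, ih]
      push_cast; ring
  have := h (k + 1)
  push_cast at this
  rw [eq_comm, ← show ((k : ℤ) + 1) * (k + 1 + 1) = (k + 1) * (k + 2) by ring, ← this]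
  simp

theorem isAffinePerm_iff {k : ℕ} {x : Equiv.Perm ℤ} :
    IsAffinePerm k x ↔
      IsPeriodicPerm k x ∧ ∑ a : ZMod (k + 1), (x (a.val : ℤ) - (a.val : ℤ)) = 0 := by
  refine and_congr_right fun hx => ?_
  rw [← sum_Icc_intCast_zmod k fun a => x (a.val : ℤ) - (a.val : ℤ)]
  simp only [IsPeriodicPerm.displacement_eq hx, Finset.sum_sub_distrib, sum_Icc_id, sub_eq_zero]

theorem sum_displacement_sAff {k : ℕ} (hk : 1 ≤ k) (i : ZMod (k + 1)) :
    ∑ a : ZMod (k + 1), (sAff k i (a.val : ℤ) - (a.val : ℤ)) = 0 := by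
  have hne : i + 1 ≠ i := by simpa using one_ne_zero_zmod_succ hk
  have h : ∀ a : ZMod (k + 1), sAff k i (a.val : ℤ) - (a.val : ℤ) =
      (if a = i then 1 else 0) - if a = i + 1 then 1 else 0 := by
    intro a
    have ha := intCast_val_zmod a
    rw [sAff_apply hk, sAffFun, ha]
    split_ifs with h1 h2
    · exact absurd (h2.symm.trans h1) hne
    all_goals ring
  rw [Finset.sum_congr rfl fun a _ => h a]
  simp

theorem IsAffinePerm.mul_sAff {k : ℕ} (hk : 1 ≤ k) {x : Equiv.Perm ℤ} (hx : IsAffinePerm k x)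
    (i : ZMod (k + 1)) : IsAffinePerm k (x * sAff k i) := by
  rw [isAffinePerm_iff] at hx ⊢
  refine ⟨hx.1.mul (isPeriodicPerm_sAff hk i), ?_⟩
  have h : ∀ a : ZMod (k + 1), (x * sAff k i) (a.val : ℤ) - (a.val : ℤ) =
      (x ((Equiv.swap i (i + 1) a).val : ℤ) - ((Equiv.swap i (i + 1) a).val : ℤ)) +
        (sAff k i (a.val : ℤ) - (a.val : ℤ)) := by
    intro a
    have := hx.1.displacement_eq (sAff k i (a.val : ℤ))
    rw [intCast_sAff hk, intCast_val_zmod] at this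
    rw [this, Equiv.Perm.mul_apply]
    ring
  simp only [h, Finset.sum_add_distrib, sum_displacement_sAff hk, add_zero]
  rw [Equiv.sum_comp (Equiv.swap i (i + 1)) fun a : ZMod (k + 1) => x (a.val : ℤ) - (a.val : ℤ)]
  exact hx.2

theorem IsAffinePerm.eq_one_of_no_descent {k : ℕ} {x : Equiv.Perm ℤ} (hx : IsAffinePerm k x)
    (h : ∀ i : ZMod (k + 1), x (i.val : ℤ) < x ((i.val : ℤ) + 1)) : x = 1 := by
  rw [isAffinePerm_iff] at hx
  have hlt : ∀ j : ℤ, x j < x (j + 1) := by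
    intro j
    obtain ⟨m, hm⟩ := exists_eq_val_add_mul k j
    have h1 := hx.1.apply_add_mul ((j : ZMod (k + 1)).val : ℤ) m
    have h2 := hx.1.apply_add_mul (((j : ZMod (k + 1)).val : ℤ) + 1) m
    rw [add_right_comm] at h2
    rw [← hm] at h1 h2
    have := h j
    linarith
  have hmono : StrictMono x := strictMono_int_of_lt_succ hlt
  have hsucc : ∀ j : ℤ, x (j + 1) = x j + 1 := by
    intro j
    obtain ⟨l, hl⟩ := x.surjective (x j + 1)
    have h1 : j < l := hmono.lt_iff_lt.1 (by omega)
    have h2 := hmono.monotone (show j + 1 ≤ l by omega)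
    have := hlt j
    omega
  have htrans : ∀ j : ℤ, x j = x 0 + j := by
    intro j
    induction j using Int.induction_on with
    | zero => simp
    | succ j ih => rw [hsucc, ih]; ring
    | pred j ih =>
      have := hsucc (-(j : ℤ) - 1)
      rw [sub_add_cancel, ih] at this
      linarith
  have h0 : x 0 = 0 := by
    have h2 := hx.2
    have : ∀ a : ZMod (k + 1), x (a.val : ℤ) - (a.val : ℤ) = x 0 := fun a => by
      rw [htrans]; ring
    simp only [this, Finset.sum_const, Finset.card_univ, ZMod.card, nsmul_eq_mul] at h2
    rcases mul_eq_zero.1 h2 with h3 | h3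
    · exact absurd h3 (by positivity)
    · exact h3
  ext j
  rw [htrans, h0, zero_add, Equiv.Perm.one_apply]

theorem IsAffinePerm.exists_word {k : ℕ} (hk : 1 ≤ k) {x : Equiv.Perm ℤ}
    (hx : IsAffinePerm k x) :
    ∃ w : List (ZMod (k + 1)), w.length = ∑ a, CRD k x a ∧ x = (w.map (sAff k)).prod := by
  induction hn : ∑ a, CRD k x a generalizing x with
  | zero =>
    refine ⟨[], rfl, hx.eq_one_of_no_descent fun i => ?_⟩
    by_contra hi
    have hne : x ((i.val : ℤ) + 1) ≠ x (i.val : ℤ) := fun h => by simpa using x.injective h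
    have := IsPeriodicPerm.sum_crd_mul_sAff_of_descent hk hx.1 (lt_of_le_of_ne (not_lt.1 hi) hne)
    omega
  | succ n ih =>
    by_cases h : ∀ i : ZMod (k + 1), x (i.val : ℤ) < x ((i.val : ℤ) + 1)
    · rw [hx.eq_one_of_no_descent h, sum_crd_one] at hn
      omega
    · push Not at h
      obtain ⟨i, hi⟩ := h
      have hne : x ((i.val : ℤ) + 1) ≠ x (i.val : ℤ) := fun h => by simpa using x.injective h
      have := IsPeriodicPerm.sum_crd_mul_sAff_of_descent hk hx.1 (lt_of_le_of_ne hi hne)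
      obtain ⟨w, hw, hw'⟩ := ih (hx.mul_sAff hk i) (by omega)
      refine ⟨w ++ [i], by simp [hw], ?_⟩
      simp only [List.map_append, List.map_cons, List.map_nil, List.prod_append, List.prod_cons,
        List.prod_nil, mul_one]
      rw [← hw', mul_assoc, sAff_mul_self hk, mul_one]

/-- `ℓ(x) = ∑_{i ∈ I} CRD(x)_i`. -/
theorem length_eq_sum_crd (k : ℕ) (hk : 1 ≤ k) (x : Equiv.Perm ℤ)
    (hx : IsAffinePerm k x) :
    affLen k x = ∑ i : ZMod (k + 1), CRD k x i := by
  have hmem := hx.exists_word hk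
  refine le_antisymm (Nat.sInf_le hmem) (le_csInf ⟨_, hmem⟩ ?_)
  rintro n ⟨w, rfl, rfl⟩
  exact sum_crd_prod_le_length hk w
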